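/- Let f : ℝ³ → ℝ be a bounded C² function whose first and second partial derivatives are bounded. Then for every a ∈ ℝ³, lim_{λ→∞} λ²·∫_{ℝ³} f(u)·δ_{a,λ}(u)^{(2+γ)/(2−γ)}·λ·(∂δ_{a,λ}/∂λ)(u) du = −((2−γ)/8)·c₂·Δ_{θ₀}f(a). -/

import Mathlib

open MeasureTheory Real

/-- The standard bubble
`δ_{a,λ}(x,y,t) = c₀·λ^{2−γ}·[(1 + λ²((x−x_a)² + (y−y_a)²))² + λ⁴(t − t_a + 2(x_a y − x y_a))²]^{−(2−γ)/2}`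
on `ℝ³`. -/
noncomputable def bubble (γ c₀ : ℝ) (a : ℝ × ℝ × ℝ) (l : ℝ) (u : ℝ × ℝ × ℝ) : ℝ :=
  c₀ * l ^ (2 - γ) *
    ((1 + l ^ 2 * ((u.1 - a.1) ^ 2 + (u.2.1 - a.2.1) ^ 2)) ^ 2
        + l ^ 4 * (u.2.2 - a.2.2 + 2 * (a.1 * u.2.1 - u.1 * a.2.1)) ^ 2) ^ (-(2 - γ) / 2)

/-- The homogeneous (gauge) distance
`d(a_i,a_j) = [((x_i−x_j)² + (y_i−y_j)²)² + (t_i − t_j + 2x_j y_i − 2x_i y_j)²]^{1/4}`. -/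
noncomputable def gdist (ai aj : ℝ × ℝ × ℝ) : ℝ :=
  (((ai.1 - aj.1) ^ 2 + (ai.2.1 - aj.2.1) ^ 2) ^ 2
      + (ai.2.2 - aj.2.2 + 2 * aj.1 * ai.2.1 - 2 * ai.1 * aj.2.1) ^ 2) ^ ((1 : ℝ) / 4)

/-- The interaction quantity
`ε_ij = (λ_i/λ_j + λ_j/λ_i + λ_i λ_j d(a_i,a_j)²)^{−(2−γ)}`. -/
noncomputable def epsb (γ : ℝ) (ai aj : ℝ × ℝ × ℝ) (li lj : ℝ) : ℝ :=
  (li / lj + lj / li + li * lj * gdist ai aj ^ 2) ^ (-(2 - γ))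

/-- The Heisenberg vector field `X = ∂/∂x + 2y·∂/∂t`. -/
noncomputable def Xop (f : ℝ × ℝ × ℝ → ℝ) (p : ℝ × ℝ × ℝ) : ℝ :=
  fderiv ℝ f p (1, 0, 2 * p.2.1)

/-- The Heisenberg vector field `Y = ∂/∂y − 2x·∂/∂t`. -/
noncomputable def Yop (f : ℝ × ℝ × ℝ → ℝ) (p : ℝ × ℝ × ℝ) : ℝ :=
  fderiv ℝ f p (0, 1, -(2 * p.1))

/-- The sub-Laplacian `Δ_{θ₀} = (1/4)(X² + Y²)`. -/
noncomputable def subLap (f : ℝ × ℝ × ℝ → ℝ) (p : ℝ × ℝ × ℝ) : ℝ :=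
  (1 / 4) * (Xop (Xop f) p + Yop (Yop f) p)

/-- The constant `c₂ = 4·c₀^{4/(2−γ)}·∫ (x²+y²)/((1+x²+y²)²+t²)² dx dy dt`. -/
noncomputable def c2const (γ c₀ : ℝ) : ℝ :=
  4 * c₀ ^ (4 / (2 - γ)) *
    ∫ p : ℝ × ℝ × ℝ,
      (p.1 ^ 2 + p.2.1 ^ 2) / ((1 + p.1 ^ 2 + p.2.1 ^ 2) ^ 2 + p.2.2 ^ 2) ^ 2

/-- The denominator `(1 + x² + y²)² + t²` of the bubble profile. -/
noncomputable def bubbleDenom (w : ℝ × ℝ × ℝ) : ℝ :=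
  (1 + w.1 ^ 2 + w.2.1 ^ 2) ^ 2 + w.2.2 ^ 2

/-- The profile of the dilation derivative of the bubble. -/
noncomputable def bubbleKernel (w : ℝ × ℝ × ℝ) : ℝ :=
  (1 - (w.1 ^ 2 + w.2.1 ^ 2) ^ 2 - w.2.2 ^ 2) / bubbleDenom w ^ 3

lemma one_le_bubbleDenom (w : ℝ × ℝ × ℝ) : 1 ≤ bubbleDenom w := by
  unfold bubbleDenom
  nlinarith [sq_nonneg w.1, sq_nonneg w.2.1, sq_nonneg w.2.2,
    sq_nonneg (w.1 ^ 2 + w.2.1 ^ 2)]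

lemma bubbleDenom_pos (w : ℝ × ℝ × ℝ) : 0 < bubbleDenom w :=
  zero_lt_one.trans_le (one_le_bubbleDenom w)

lemma continuous_bubbleDenom : Continuous bubbleDenom := by
  unfold bubbleDenom
  fun_prop

lemma continuous_bubbleKernel : Continuous bubbleKernel := by
  unfold bubbleKernel
  exact Continuous.div (by fun_prop) (continuous_bubbleDenom.pow 3)
    fun w => (pow_pos (bubbleDenom_pos w) 3).ne'

lemma abs_bubbleKernel_le (w : ℝ × ℝ × ℝ) : |bubbleKernel w| ≤ 1 / bubbleDenom w ^ 2 := by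
  have h := bubbleDenom_pos w
  rw [bubbleKernel, abs_div, abs_of_pos (pow_pos h 3), div_le_div_iff₀ (by positivity)
    (by positivity), one_mul, pow_succ' _ 2]
  refine mul_le_mul_of_nonneg_right ?_ (by positivity)
  rw [abs_le]
  unfold bubbleDenom
  constructor <;>
  nlinarith [sq_nonneg w.1, sq_nonneg w.2.1, sq_nonneg w.2.2,
    sq_nonneg (w.1 ^ 2 + w.2.1 ^ 2)]

lemma integral_comp_diag (α β κ : ℝ) (h : α * (β * κ) ≠ 0) (g : ℝ × ℝ × ℝ → ℝ) :
    ∫ w : ℝ × ℝ × ℝ, g (α * w.1, β * w.2.1, κ * w.2.2) =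
      |(α * (β * κ))⁻¹| * ∫ w, g w := by
  let D : (ℝ × ℝ × ℝ) →ₗ[ℝ] ℝ × ℝ × ℝ :=
    (α • LinearMap.id).prodMap ((β • LinearMap.id).prodMap (κ • LinearMap.id))
  have hdet : LinearMap.det D = α * (β * κ) := by
    simp [D, LinearMap.det_prodMap]
  have hD : LinearMap.det D ≠ 0 := hdet ▸ h
  have hHaar : (volume : Measure (ℝ × ℝ × ℝ)).IsAddHaarMeasure :=
    Measure.prod.instIsAddHaarMeasure (volume : Measure ℝ) (volume : Measure (ℝ × ℝ))
  have hmap := Measure.map_linearMap_addHaar_eq_smul_addHaar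
    (volume : Measure (ℝ × ℝ × ℝ)) hD
  have hemb : MeasurableEmbedding D :=
    (LinearEquiv.ofIsUnitDet (v := Module.finBasis ℝ (ℝ × ℝ × ℝ))
      (v' := Module.finBasis ℝ (ℝ × ℝ × ℝ)) (f := D)
      (by simpa using hD)).toContinuousLinearEquiv.toHomeomorph.measurableEmbedding
  have := hemb.integral_map (μ := volume) g
  rw [hmap, integral_smul_measure, hdet, ENNReal.toReal_ofReal (abs_nonneg _)] at this
  rw [← smul_eq_mul, this]
  rfl

lemma integral_comp_swap_fst (g : ℝ × ℝ × ℝ → ℝ) :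
    ∫ w : ℝ × ℝ × ℝ, g (w.2.1, w.1, w.2.2) = ∫ w, g w := by
  have h1 : MeasurePreserving (MeasurableEquiv.prodAssoc : (ℝ × ℝ) × ℝ ≃ᵐ ℝ × ℝ × ℝ) :=
    volume_preserving_prodAssoc
  have h2 : MeasurePreserving (MeasurableEquiv.prodCongr (MeasurableEquiv.prodComm : ℝ × ℝ ≃ᵐ ℝ × ℝ)
      (MeasurableEquiv.refl ℝ)) :=
    (Measure.measurePreserving_swap (μ := (volume : Measure ℝ)) (ν := (volume : Measure ℝ))).prod
      (MeasurePreserving.id (volume : Measure ℝ))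
  rw [← h1.integral_comp', ← h1.integral_comp' (g := g), ← h2.integral_comp']
  rfl

lemma integral_comp_heisenberg_translate (a : ℝ × ℝ × ℝ) (g : ℝ × ℝ × ℝ → ℝ) :
    ∫ w : ℝ × ℝ × ℝ, g (a.1 + w.1, a.2.1 + w.2.1,
      a.2.2 + w.2.2 - 2 * (a.1 * w.2.1 - w.1 * a.2.1)) = ∫ w, g w := by
  let e : ℝ × ℝ × ℝ ≃ₜ ℝ × ℝ × ℝ :=
    { toFun := fun w => (a.1 + w.1, a.2.1 + w.2.1,
        a.2.2 + w.2.2 - 2 * (a.1 * w.2.1 - w.1 * a.2.1))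
      invFun := fun w => (w.1 - a.1, w.2.1 - a.2.1,
        w.2.2 - a.2.2 + 2 * (a.1 * (w.2.1 - a.2.1) - (w.1 - a.1) * a.2.1))
      left_inv := fun w => by ext <;> simp; ring
      right_inv := fun w => by ext <;> simp; ring
      continuous_toFun := by fun_prop
      continuous_invFun := by fun_prop }
  have he : MeasurePreserving e := by
    refine (measurePreserving_add_left volume a.1).skew_product
      (g := fun (x : ℝ) (q : ℝ × ℝ) => (a.2.1 + q.1, a.2.2 + q.2 - 2 * (a.1 * q.1 - x * a.2.1)))
      (by fun_prop) (.of_forall fun x => ?_)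
    refine MeasurePreserving.map_eq ?_
    refine (measurePreserving_add_left volume a.2.1).skew_product
      (g := fun (y t : ℝ) => a.2.2 + t - 2 * (a.1 * y - x * a.2.1)) (by fun_prop)
      (.of_forall fun y => ?_)
    simpa only [add_sub_right_comm] using
      map_add_left_eq_self (volume : Measure ℝ) (a.2.2 - 2 * (a.1 * y - x * a.2.1))
  exact he.integral_comp e.measurableEmbedding g

lemma integrable_bubble_weight :
    Integrable fun w : ℝ × ℝ × ℝ =>
      (1 + w.1 ^ 2 + w.2.1 ^ 2 + |w.2.2|) / bubbleDenom w ^ 2 := by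
  have h1 : Integrable fun x : ℝ => (1 + x ^ 2) ^ (-(3 / 4) : ℝ) := by
    have := integrable_rpow_neg_one_add_norm_sq (E := ℝ) (μ := volume) (r := 3 / 2)
      (by norm_num)
    convert this using 2 with x
    rw [norm_eq_abs, sq_abs]
    norm_num
  have h3 := (h1.mul_prod (h1.mul_prod h1)).const_mul 2
  refine h3.mono' ?_ (.of_forall fun w => ?_)
  · exact (Continuous.div (by fun_prop) (continuous_bubbleDenom.pow 2)
      fun w => (pow_pos (bubbleDenom_pos w) 2).ne').aestronglyMeasurable
  have hN := bubbleDenom_pos w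
  rw [norm_of_nonneg (by positivity)]
  obtain ⟨x, y, t⟩ := w
  set N := bubbleDenom (x, y, t) with hNdef
  have hN' : N = (1 + x ^ 2 + y ^ 2) ^ 2 + t ^ 2 := rfl
  dsimp only
  have hx : 1 + x ^ 2 ≤ N ^ (1 / 2 : ℝ) := by
    rw [← sqrt_eq_rpow]
    apply le_sqrt_of_sq_le
    rw [hN']
    nlinarith [sq_nonneg x, sq_nonneg y, sq_nonneg t, mul_nonneg (sq_nonneg x) (sq_nonneg y)]
  have hy : 1 + y ^ 2 ≤ N ^ (1 / 2 : ℝ) := by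
    rw [← sqrt_eq_rpow]
    apply le_sqrt_of_sq_le
    rw [hN']
    nlinarith [sq_nonneg x, sq_nonneg y, sq_nonneg t, mul_nonneg (sq_nonneg x) (sq_nonneg y)]
  have ht : 1 + t ^ 2 ≤ N := by
    rw [hN']
    nlinarith [sq_nonneg x, sq_nonneg y, sq_nonneg (x ^ 2 + y ^ 2)]
  have hW : 1 + x ^ 2 + y ^ 2 + |t| ≤ 2 * N ^ (1 / 2 : ℝ) := by
    rw [← sqrt_eq_rpow]
    have e1 : 1 + x ^ 2 + y ^ 2 ≤ √N := by
      apply le_sqrt_of_sq_le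
      rw [hN']
      nlinarith [sq_nonneg t]
    have e2 : |t| ≤ √N := by
      apply le_sqrt_of_sq_le
      rw [hN', sq_abs]
      nlinarith [sq_nonneg (1 + x ^ 2 + y ^ 2)]
    linarith
  have hbx := rpow_le_rpow_of_nonpos (by positivity) hx (by norm_num : (-(3 / 4) : ℝ) ≤ 0)
  have hby := rpow_le_rpow_of_nonpos (by positivity) hy (by norm_num : (-(3 / 4) : ℝ) ≤ 0)
  have hbt := rpow_le_rpow_of_nonpos (by positivity) ht (by norm_num : (-(3 / 4) : ℝ) ≤ 0)
  rw [← rpow_mul hN.le] at hbx hby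
  calc (1 + x ^ 2 + y ^ 2 + |t|) / N ^ 2 ≤ 2 * N ^ (1 / 2 : ℝ) / N ^ 2 := by gcongr
    _ = 2 * (N ^ (1 / 2 * -(3 / 4) : ℝ) * (N ^ (1 / 2 * -(3 / 4) : ℝ) * N ^ (-(3 / 4) : ℝ))) := by
      rw [← rpow_add hN, ← rpow_add hN, mul_div_assoc, ← rpow_natCast N 2, ← rpow_sub hN]
      norm_num
    _ ≤ _ := by gcongr

lemma integrable_div_bubbleDenom_sq {q : ℝ × ℝ × ℝ → ℝ} (hq : Continuous q) (C : ℝ)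
    (hC : ∀ w, |q w| ≤ C * (1 + w.1 ^ 2 + w.2.1 ^ 2 + |w.2.2|)) :
    Integrable fun w => q w / bubbleDenom w ^ 2 := by
  refine (integrable_bubble_weight.const_mul C).mono' ?_ (.of_forall fun w => ?_)
  · exact (hq.div (continuous_bubbleDenom.pow 2)
      fun w => (pow_pos (bubbleDenom_pos w) 2).ne').aestronglyMeasurable
  have hN := bubbleDenom_pos w
  rw [norm_div, norm_of_nonneg (by positivity : 0 ≤ bubbleDenom w ^ 2), ← mul_div_assoc]
  exact div_le_div_of_nonneg_right (hC w) (by positivity)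

lemma abs_mul_bubbleKernel_le (x : ℝ) (w : ℝ × ℝ × ℝ) :
    |x * bubbleKernel w| ≤ |x| / bubbleDenom w ^ 2 := by
  rw [abs_mul, div_eq_mul_one_div]
  exact mul_le_mul_of_nonneg_left (abs_bubbleKernel_le w) (abs_nonneg x)

lemma integrable_mul_bubbleKernel {q : ℝ × ℝ × ℝ → ℝ} (hq : Continuous q) (C : ℝ)
    (hC : ∀ w, |q w| ≤ C * (1 + w.1 ^ 2 + w.2.1 ^ 2 + |w.2.2|)) :
    Integrable fun w => q w * bubbleKernel w :=
  (integrable_div_bubbleDenom_sq hq.abs C (by simpa using hC)).mono'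
    (hq.mul continuous_bubbleKernel).aestronglyMeasurable
    (.of_forall fun w => abs_mul_bubbleKernel_le (q w) w)

lemma hasDerivAt_bubbleDenom_dilate (w : ℝ × ℝ × ℝ) (l : ℝ) :
    HasDerivAt (fun l : ℝ => bubbleDenom (l * w.1, l * w.2.1, l ^ 2 * w.2.2))
      (4 * l * (w.1 ^ 2 + w.2.1 ^ 2) * (1 + l ^ 2 * (w.1 ^ 2 + w.2.1 ^ 2))
        + 4 * l ^ 3 * w.2.2 ^ 2) l := by
  have h1 := ((((hasDerivAt_pow 2 l).mul_const (w.1 ^ 2 + w.2.1 ^ 2)).const_add 1).pow 2).add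
    ((hasDerivAt_pow 4 l).mul_const (w.2.2 ^ 2))
  convert! h1 using 1
  · ext l
    simp only [bubbleDenom, Pi.add_apply, Pi.pow_apply]
    ring
  · simp
    ring

lemma hasDerivAt_dilated_density (c : ℝ) (w : ℝ × ℝ × ℝ) (l : ℝ) :
    HasDerivAt (fun l : ℝ => l ^ 4 * c / bubbleDenom (l * w.1, l * w.2.1, l ^ 2 * w.2.2) ^ 2)
      (4 * l ^ 3 * (c * bubbleKernel (l * w.1, l * w.2.1, l ^ 2 * w.2.2))) l := by
  have hN := bubbleDenom_pos (l * w.1, l * w.2.1, l ^ 2 * w.2.2)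
  convert! ((hasDerivAt_pow 4 l).mul_const c).div ((hasDerivAt_bubbleDenom_dilate w l).pow 2)
    (pow_pos hN 2).ne' using 1
  have hA : 1 - ((l * w.1) ^ 2 + (l * w.2.1) ^ 2) ^ 2 - (l ^ 2 * w.2.2) ^ 2 =
      bubbleDenom (l * w.1, l * w.2.1, l ^ 2 * w.2.2) - l / 2 *
        (4 * l * (w.1 ^ 2 + w.2.1 ^ 2) * (1 + l ^ 2 * (w.1 ^ 2 + w.2.1 ^ 2))
          + 4 * l ^ 3 * w.2.2 ^ 2) := by
    simp only [bubbleDenom]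
    ring
  rw [bubbleKernel, hA]
  simp only [Pi.pow_apply]
  generalize 4 * l * (w.1 ^ 2 + w.2.1 ^ 2) * (1 + l ^ 2 * (w.1 ^ 2 + w.2.1 ^ 2))
    + 4 * l ^ 3 * w.2.2 ^ 2 = D
  generalize bubbleDenom (l * w.1, l * w.2.1, l ^ 2 * w.2.2) = N at hN
  have hN' := hN.ne'
  push_cast
  field_simp
  ring

lemma bubbleDenom_dilate_ge (w : ℝ × ℝ × ℝ) {l : ℝ} (hl : 1 / 2 ≤ l) :
    bubbleDenom w / 16 ≤ bubbleDenom (l * w.1, l * w.2.1, l ^ 2 * w.2.2) := by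
  have h2 : 1 / 4 ≤ l ^ 2 := by nlinarith
  have h4 : 1 / 16 ≤ l ^ 4 := by nlinarith
  have hr : (1 + w.1 ^ 2 + w.2.1 ^ 2) / 4 ≤ 1 + (l * w.1) ^ 2 + (l * w.2.1) ^ 2 := by
    nlinarith [mul_nonneg (sub_nonneg.2 h2) (sq_nonneg w.1),
      mul_nonneg (sub_nonneg.2 h2) (sq_nonneg w.2.1)]
  have hr2 := pow_le_pow_left₀ (by positivity) hr 2
  simp only [bubbleDenom]
  nlinarith [mul_nonneg (sub_nonneg.2 h4) (sq_nonneg w.2.2)]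

lemma integral_homogeneous_mul_bubbleKernel {q : ℝ × ℝ × ℝ → ℝ} (hq : Continuous q) (d : ℕ)
    (hd : ∀ (l : ℝ) (w : ℝ × ℝ × ℝ), q (l * w.1, l * w.2.1, l ^ 2 * w.2.2) = l ^ d * q w)
    (h_integrable : Integrable fun w => q w / bubbleDenom w ^ 2) :
    4 * ∫ w, q w * bubbleKernel w = -d * ∫ w, q w / bubbleDenom w ^ 2 := by
  let F : ℝ → ℝ × ℝ × ℝ → ℝ := fun l w =>
    l ^ 4 * q w / bubbleDenom (l * w.1, l * w.2.1, l ^ 2 * w.2.2) ^ 2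
  have hcont : ∀ l : ℝ, Continuous fun w : ℝ × ℝ × ℝ => (l * w.1, l * w.2.1, l ^ 2 * w.2.2) :=
    fun l => by fun_prop
  have key := hasDerivAt_integral_of_dominated_loc_of_deriv_le (μ := volume) (F := F)
    (F' := fun l w => 4 * l ^ 3 * (q w * bubbleKernel (l * w.1, l * w.2.1, l ^ 2 * w.2.2)))
    (bound := fun w => 32 * 256 * |q w / bubbleDenom w ^ 2|)
    (x₀ := 1) (s := Set.Ioo (1 / 2) 2) (Ioo_mem_nhds (by norm_num) (by norm_num))
    (.of_forall fun l => ((hq.const_mul _).div ((continuous_bubbleDenom.comp (hcont l)).pow 2)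
      fun w => (pow_pos (bubbleDenom_pos _) 2).ne').aestronglyMeasurable)
    (by simpa [F] using h_integrable)
    ((hq.mul (continuous_bubbleKernel.comp (hcont 1))).const_mul _).aestronglyMeasurable
    (.of_forall fun w l hl => by
      have hN := bubbleDenom_pos w
      have hl0 : 0 < l := by linarith [hl.1]
      have hl3 : l ^ 3 ≤ 2 ^ 3 := pow_le_pow_left₀ hl0.le hl.2.le 3
      have hge := bubbleDenom_dilate_ge w hl.1.le
      rw [norm_mul, norm_of_nonneg (by positivity), abs_div, abs_of_pos (pow_pos hN 2)]
      calc 4 * l ^ 3 * ‖q w * bubbleKernel (l * w.1, l * w.2.1, l ^ 2 * w.2.2)‖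
          ≤ 4 * 2 ^ 3 * (|q w| / (bubbleDenom w / 16) ^ 2) := by
            gcongr
            refine (abs_mul_bubbleKernel_le _ _).trans ?_
            gcongr
        _ = _ := by ring)
    (h_integrable.abs.const_mul _)
    (.of_forall fun w l _ => hasDerivAt_dilated_density (q w) w l)
  have hscale : (fun l : ℝ => ∫ w, F l w) =ᶠ[nhds 1]
      fun l => (l ^ d)⁻¹ * ∫ w, q w / bubbleDenom w ^ 2 := by
    filter_upwards [Ioi_mem_nhds (zero_lt_one' ℝ)] with l hl
    have hl : 0 < l := hl
    have hF : F l = fun w => l ^ 4 * (l ^ d)⁻¹ *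
        (fun w => q w / bubbleDenom w ^ 2) (l * w.1, l * w.2.1, l ^ 2 * w.2.2) := by
      ext w
      simp only [F, hd]
      field_simp
    rw [hF, integral_const_mul, integral_comp_diag l l (l ^ 2) (by positivity)
      fun w => q w / bubbleDenom w ^ 2, abs_of_pos (by positivity)]
    field_simp
  have h2 : HasDerivAt (fun l : ℝ => (l ^ d)⁻¹ * ∫ w, q w / bubbleDenom w ^ 2)
      (-d * ∫ w, q w / bubbleDenom w ^ 2) 1 := by
    convert! ((hasDerivAt_pow d (1 : ℝ)).fun_inv (by simp)).mul_const
      (∫ w, q w / bubbleDenom w ^ 2) using 1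
    simp
  have := key.2.unique (h2.congr_of_eventuallyEq hscale)
  rw [← this, ← integral_const_mul]
  simp

lemma integral_eq_zero_of_reflection {α β κ : ℝ} (h : |α * (β * κ)| = 1) {g : ℝ × ℝ × ℝ → ℝ}
    (hg : ∀ w : ℝ × ℝ × ℝ, g (α * w.1, β * w.2.1, κ * w.2.2) = -g w) :
    ∫ w, g w = 0 := by
  have h1 := integral_comp_diag α β κ (by rw [← abs_pos, h]; exact one_pos) g
  simp only [hg, integral_neg, abs_inv, h] at h1
  linarith

lemma integral_bubbleKernel : ∫ w, bubbleKernel w = 0 := by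
  have := integral_homogeneous_mul_bubbleKernel (q := fun _ => 1) continuous_const 0 (by simp)
    (integrable_div_bubbleDenom_sq continuous_const 1 fun w => by
      rw [abs_one, one_mul]; nlinarith [sq_nonneg w.1, sq_nonneg w.2.1, abs_nonneg w.2.2])
  simpa using this

lemma integral_sq_fst_mul_bubbleKernel :
    ∫ w : ℝ × ℝ × ℝ, w.1 ^ 2 * bubbleKernel w =
      -(1 / 4) * ∫ w : ℝ × ℝ × ℝ, (w.1 ^ 2 + w.2.1 ^ 2) / bubbleDenom w ^ 2 := by
  have hb : ∀ w : ℝ × ℝ × ℝ, |w.1 ^ 2 + w.2.1 ^ 2| ≤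
      1 * (1 + w.1 ^ 2 + w.2.1 ^ 2 + |w.2.2|) := fun w => by
    rw [abs_of_nonneg (by positivity)]; linarith [abs_nonneg w.2.2]
  have h := integral_homogeneous_mul_bubbleKernel
    (q := fun w : ℝ × ℝ × ℝ => w.1 ^ 2 + w.2.1 ^ 2) (by fun_prop) 2 (fun l w => by ring)
    (integrable_div_bubbleDenom_sq (by fun_prop) 1 hb)
  have hsum : ∫ w : ℝ × ℝ × ℝ, (w.1 ^ 2 + w.2.1 ^ 2) * bubbleKernel w =
      (∫ w : ℝ × ℝ × ℝ, w.1 ^ 2 * bubbleKernel w)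
        + ∫ w : ℝ × ℝ × ℝ, w.2.1 ^ 2 * bubbleKernel w := by
    simp only [add_mul]
    refine integral_add (integrable_mul_bubbleKernel (by fun_prop) 1 fun w => ?_)
      (integrable_mul_bubbleKernel (by fun_prop) 1 fun w => ?_)
    all_goals
      rw [abs_of_nonneg (by positivity)]
      nlinarith [sq_nonneg w.1, sq_nonneg w.2.1, abs_nonneg w.2.2]
  have hswap := integral_comp_swap_fst fun w => w.1 ^ 2 * bubbleKernel w
  have hK : ∀ w : ℝ × ℝ × ℝ, bubbleKernel (w.2.1, w.1, w.2.2) = bubbleKernel w := fun w => by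
    simp only [bubbleKernel, bubbleDenom]
    ring_nf
  simp only [hK] at hswap
  push_cast at h
  linarith

lemma integral_sq_snd_mul_bubbleKernel :
    ∫ w : ℝ × ℝ × ℝ, w.2.1 ^ 2 * bubbleKernel w =
      -(1 / 4) * ∫ w : ℝ × ℝ × ℝ, (w.1 ^ 2 + w.2.1 ^ 2) / bubbleDenom w ^ 2 := by
  rw [← integral_sq_fst_mul_bubbleKernel,
    ← integral_comp_swap_fst fun w => w.1 ^ 2 * bubbleKernel w]
  refine integral_congr_ae (.of_forall fun w => ?_)
  simp only [bubbleKernel, bubbleDenom]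
  ring_nf

lemma integral_fst_mul_bubbleKernel : ∫ w : ℝ × ℝ × ℝ, w.1 * bubbleKernel w = 0 :=
  integral_eq_zero_of_reflection (α := -1) (β := 1) (κ := 1) (by simp) fun w => by
    simp only [bubbleKernel, bubbleDenom]; ring

lemma integral_snd_mul_bubbleKernel : ∫ w : ℝ × ℝ × ℝ, w.2.1 * bubbleKernel w = 0 :=
  integral_eq_zero_of_reflection (α := 1) (β := -1) (κ := 1) (by simp) fun w => by
    simp only [bubbleKernel, bubbleDenom]; ring

lemma integral_thd_mul_bubbleKernel : ∫ w : ℝ × ℝ × ℝ, w.2.2 * bubbleKernel w = 0 :=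
  integral_eq_zero_of_reflection (α := 1) (β := 1) (κ := -1) (by simp) fun w => by
    simp only [bubbleKernel, bubbleDenom]; ring

lemma integral_fst_mul_snd_mul_bubbleKernel :
    ∫ w : ℝ × ℝ × ℝ, w.1 * w.2.1 * bubbleKernel w = 0 :=
  integral_eq_zero_of_reflection (α := -1) (β := 1) (κ := 1) (by simp) fun w => by
    simp only [bubbleKernel, bubbleDenom]; ring

/-- The group difference `a⁻¹ ∘ u` on the Heisenberg group. -/
def heisenbergDiff (a u : ℝ × ℝ × ℝ) : ℝ × ℝ × ℝ :=
  (u.1 - a.1, u.2.1 - a.2.1, u.2.2 - a.2.2 + 2 * (a.1 * u.2.1 - u.1 * a.2.1))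

/-- The anisotropic dilation on the Heisenberg group. -/
def heisenbergDilate (l : ℝ) (w : ℝ × ℝ × ℝ) : ℝ × ℝ × ℝ :=
  (l * w.1, l * w.2.1, l ^ 2 * w.2.2)

lemma bubble_eq (γ c₀ : ℝ) (a : ℝ × ℝ × ℝ) (l : ℝ) (u : ℝ × ℝ × ℝ) :
    bubble γ c₀ a l u = c₀ * l ^ (2 - γ) *
      bubbleDenom (heisenbergDilate l (heisenbergDiff a u)) ^ (-(2 - γ) / 2) := by
  unfold bubble bubbleDenom heisenbergDilate heisenbergDiff
  congr 2
  ring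

lemma mul_deriv_bubble (γ c₀ : ℝ) (a u : ℝ × ℝ × ℝ) {l : ℝ} (hl : 0 < l) :
    l * deriv (fun s => bubble γ c₀ a s u) l =
      (2 - γ) * bubble γ c₀ a l u *
        (bubbleDenom (heisenbergDilate l (heisenbergDiff a u)) ^ 2 *
          bubbleKernel (heisenbergDilate l (heisenbergDiff a u))) := by
  simp only [bubble_eq]
  generalize heisenbergDiff a u = w
  have hN := bubbleDenom_pos (heisenbergDilate l w)
  have hA : 1 - ((l * w.1) ^ 2 + (l * w.2.1) ^ 2) ^ 2 - (l ^ 2 * w.2.2) ^ 2 =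
      bubbleDenom (heisenbergDilate l w) - l / 2 *
        (4 * l * (w.1 ^ 2 + w.2.1 ^ 2) * (1 + l ^ 2 * (w.1 ^ 2 + w.2.1 ^ 2))
          + 4 * l ^ 3 * w.2.2 ^ 2) := by
    simp only [bubbleDenom, heisenbergDilate]
    ring
  have hder := ((hasDerivAt_rpow_const (p := 2 - γ) (Or.inl hl.ne')).const_mul c₀).fun_mul
    (HasDerivAt.rpow_const (p := -(2 - γ) / 2) (hasDerivAt_bubbleDenom_dilate w l)
      (Or.inl hN.ne'))
  have hK : bubbleKernel (heisenbergDilate l w) =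
      (1 - ((l * w.1) ^ 2 + (l * w.2.1) ^ 2) ^ 2 - (l ^ 2 * w.2.2) ^ 2) /
        bubbleDenom (heisenbergDilate l w) ^ 3 := rfl
  change l * deriv (fun s => c₀ * s ^ (2 - γ) *
    bubbleDenom (s * w.1, s * w.2.1, s ^ 2 * w.2.2) ^ (-(2 - γ) / 2)) l = _
  rw [hder.deriv, hK, hA]
  change l * (c₀ * ((2 - γ) * l ^ (2 - γ - 1)) *
    bubbleDenom (heisenbergDilate l w) ^ (-(2 - γ) / 2) + c₀ * l ^ (2 - γ) *
      (_ * (-(2 - γ) / 2) * bubbleDenom (heisenbergDilate l w) ^ (-(2 - γ) / 2 - 1))) = _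
  generalize 4 * l * (w.1 ^ 2 + w.2.1 ^ 2) * (1 + l ^ 2 * (w.1 ^ 2 + w.2.1 ^ 2))
    + 4 * l ^ 3 * w.2.2 ^ 2 = D
  rw [rpow_sub_one hl.ne', rpow_sub_one hN.ne']
  have hN' := hN.ne'
  generalize bubbleDenom (heisenbergDilate l w) = N at hN' ⊢
  generalize l ^ (2 - γ) = P
  generalize N ^ (-(2 - γ) / 2) = R
  field_simp
  ring

lemma bubble_rpow_mul_bubble {γ c₀ : ℝ} (hγ : γ < 2) (hc₀ : 0 < c₀) (a u : ℝ × ℝ × ℝ) {l : ℝ}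
    (hl : 0 < l) :
    bubble γ c₀ a l u ^ ((2 + γ) / (2 - γ)) * bubble γ c₀ a l u =
      c₀ ^ (4 / (2 - γ)) * l ^ 4 /
        bubbleDenom (heisenbergDilate l (heisenbergDiff a u)) ^ 2 := by
  have hk : 2 - γ ≠ 0 := by linarith
  have hN := bubbleDenom_pos (heisenbergDilate l (heisenbergDiff a u))
  have hpos : 0 < bubble γ c₀ a l u := by
    rw [bubble_eq]
    positivity
  rw [← rpow_add_one hpos.ne', show (2 + γ) / (2 - γ) + 1 = 4 / (2 - γ) by field_simp; ring,
    bubble_eq, mul_rpow (by positivity) (by positivity), mul_rpow hc₀.le (by positivity),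
    ← rpow_mul hl.le, ← rpow_mul hN.le,
    show (2 - γ) * (4 / (2 - γ)) = (4 : ℕ) by field_simp; norm_num,
    show -(2 - γ) / 2 * (4 / (2 - γ)) = -((2 : ℕ) : ℝ) by field_simp; norm_num,
    rpow_neg hN.le, rpow_natCast, rpow_natCast, ← div_eq_mul_inv]

lemma integral_mul_bubble_deriv {γ c₀ : ℝ} (hγ : γ < 2) (hc₀ : 0 < c₀)
    (f : ℝ × ℝ × ℝ → ℝ) (a : ℝ × ℝ × ℝ) {l : ℝ} (hl : 0 < l) :
    ∫ u : ℝ × ℝ × ℝ, f u * bubble γ c₀ a l u ^ ((2 + γ) / (2 - γ))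
        * (l * deriv (fun s => bubble γ c₀ a s u) l) =
      (2 - γ) * c₀ ^ (4 / (2 - γ)) * ∫ w : ℝ × ℝ × ℝ,
        f (a + l⁻¹ • (w.1 • (1, 0, 2 * a.2.1) + w.2.1 • (0, 1, -(2 * a.1)))
          + (l⁻¹ ^ 2 * w.2.2) • (0, 0, 1)) * bubbleKernel w := by
  have h1 : ∀ u, f u * bubble γ c₀ a l u ^ ((2 + γ) / (2 - γ))
        * (l * deriv (fun s => bubble γ c₀ a s u) l) =
      (2 - γ) * c₀ ^ (4 / (2 - γ)) * l ^ 4 *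
        (f u * bubbleKernel (heisenbergDilate l (heisenbergDiff a u))) := fun u => by
    have hN := (bubbleDenom_pos (heisenbergDilate l (heisenbergDiff a u))).ne'
    rw [mul_deriv_bubble γ c₀ a u hl]
    calc _ = (2 - γ) * f u * (bubble γ c₀ a l u ^ ((2 + γ) / (2 - γ)) * bubble γ c₀ a l u) *
          (bubbleDenom (heisenbergDilate l (heisenbergDiff a u)) ^ 2 *
            bubbleKernel (heisenbergDilate l (heisenbergDiff a u))) := by ring
      _ = _ := by
        rw [bubble_rpow_mul_bubble hγ hc₀ a u hl]
        field_simp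
  simp only [h1]
  rw [integral_const_mul, mul_assoc _ (l ^ 4), ← integral_comp_heisenberg_translate a]
  congr 1
  have h2 := integral_comp_diag l l (l ^ 2) (by positivity) fun w =>
    f (a + l⁻¹ • (w.1 • (1, 0, 2 * a.2.1) + w.2.1 • (0, 1, -(2 * a.1)))
          + (l⁻¹ ^ 2 * w.2.2) • (0, 0, 1)) * bubbleKernel w
  rw [abs_of_pos (by positivity), eq_inv_mul_iff_mul_eq₀ (by positivity)] at h2
  rw [← h2, show l * (l * l ^ 2) = l ^ 4 by ring]
  congr 1
  refine integral_congr_ae (.of_forall fun w => ?_)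
  dsimp only
  congr 2
  · ext
    · simp
      field_simp
    · simp
      field_simp
    · simp
      field_simp
      ring
  · simp only [heisenbergDilate, heisenbergDiff]
    ext
    · simp
    · simp
    · simp
      ring_nf
      simp

section Taylor

variable {E : Type*} [NormedAddCommGroup E] [NormedSpace ℝ E] {f : E → ℝ}

lemma abs_add_sub_le_of_norm_fderiv_le {C : ℝ} (hf : Differentiable ℝ f)
    (hC : ∀ p, ‖fderiv ℝ f p‖ ≤ C) (p h : E) : |f (p + h) - f p| ≤ C * ‖h‖ := by
  simpa using convex_univ.norm_image_sub_le_of_norm_fderiv_le (fun x _ => hf x)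
    (fun x _ => hC x) (Set.mem_univ p) (Set.mem_univ (p + h))

lemma abs_add_sub_sub_fderiv_le {C : ℝ} (hf : ContDiff ℝ 2 f)
    (hC : ∀ p, ‖fderiv ℝ (fderiv ℝ f) p‖ ≤ C) (p h : E) :
    |f (p + h) - f p - fderiv ℝ f p h| ≤ C * ‖h‖ ^ 2 := by
  have hf' : Differentiable ℝ (fderiv ℝ f) :=
    (hf.fderiv_right (m := 1) (by norm_num)).differentiable (by norm_num)
  have hC0 : 0 ≤ C := (norm_nonneg (fderiv ℝ (fderiv ℝ f) p)).trans (hC p)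
  have hb : ∀ x ∈ Metric.closedBall p ‖h‖, ‖fderiv ℝ f x - fderiv ℝ f p‖ ≤ C * ‖h‖ :=
    fun x hx => (convex_univ.norm_image_sub_le_of_norm_fderiv_le (fun x _ => hf' x)
      (fun x _ => hC x) (Set.mem_univ p) (Set.mem_univ x)).trans
        (mul_le_mul_of_nonneg_left (mem_closedBall_iff_norm.1 hx) hC0)
  have := (convex_closedBall p ‖h‖).norm_image_sub_le_of_norm_fderiv_le'
    (fun x _ => hf.differentiable (by norm_num) x) hb
    (Metric.mem_closedBall_self (norm_nonneg h)) (y := p + h) (by simp)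
  simpa [mul_assoc, sq] using this

lemma tendsto_sq_mul_second_order_remainder (hf : ContDiff ℝ 2 f) (a v : E) :
    Filter.Tendsto (fun l : ℝ => l ^ 2 * (f (a + l⁻¹ • v) - f a - l⁻¹ * fderiv ℝ f a v))
      Filter.atTop (nhds (1 / 2 * fderiv ℝ (fderiv ℝ f) a v v)) := by
  have hf' : Differentiable ℝ (fderiv ℝ f) :=
    (hf.fderiv_right (m := 1) (by norm_num)).differentiable (by norm_num)
  have h := convex_univ.taylor_approx_two_segment (f := f) (f' := fderiv ℝ f)
    (fun x _ => (hf.differentiable (by norm_num) x).hasFDerivAt) (Set.mem_univ a)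
    (hf' a).hasFDerivAt.hasFDerivWithinAt (v := 0) (w := v) (by simp) (by simp)
  have h2 := (h.comp_tendsto tendsto_inv_atTop_nhdsGT_zero).tendsto_div_nhds_zero.add_const
    (1 / 2 * fderiv ℝ (fderiv ℝ f) a v v)
  rw [zero_add] at h2
  refine h2.congr' ?_
  filter_upwards [Filter.eventually_gt_atTop 0] with l hl
  simp only [Function.comp_apply, smul_zero, add_zero, map_zero, zero_apply, smul_eq_mul]
  field_simp
  ring

lemma tendsto_sq_mul_increment (hf : ContDiff ℝ 2 f) (a v e : E) (s : ℝ) :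
    Filter.Tendsto
      (fun l : ℝ => l ^ 2 * (f (a + l⁻¹ • v + (l⁻¹ ^ 2 * s) • e) - f (a + l⁻¹ • v)))
      Filter.atTop (nhds (s * fderiv ℝ f a e)) := by
  have h := (hf.hasStrictFDerivAt (x := a) (by norm_num)).isLittleO
  have hinv : Filter.Tendsto (fun l : ℝ => l⁻¹) Filter.atTop (nhds 0) := tendsto_inv_atTop_zero
  have h1 : Filter.Tendsto (fun l : ℝ => a + l⁻¹ • v) Filter.atTop (nhds a) := by
    simpa using (hinv.smul_const v).const_add a
  have h2 : Filter.Tendsto (fun l : ℝ => a + l⁻¹ • v + (l⁻¹ ^ 2 * s) • e)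
      Filter.atTop (nhds a) := by
    simpa using h1.add (((hinv.pow 2).mul_const s).smul_const e)
  have h3 := h.comp_tendsto (h2.prodMk_nhds h1)
  have h4 : (fun l : ℝ => (l⁻¹ ^ 2 * s) • e) =O[Filter.atTop] fun l => l⁻¹ ^ 2 := by
    simp only [mul_smul]
    simpa only [smul_eq_mul, mul_one] using
      (Asymptotics.isBigO_refl (fun l : ℝ => l⁻¹ ^ 2) Filter.atTop).smul
      (Asymptotics.isBigO_const_const (s • e) (one_ne_zero (α := ℝ)) Filter.atTop)
  have h5 : (fun l : ℝ => f (a + l⁻¹ • v + (l⁻¹ ^ 2 * s) • e) - f (a + l⁻¹ • v)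
      - l⁻¹ ^ 2 * s * fderiv ℝ f a e) =o[Filter.atTop] fun l => l⁻¹ ^ 2 := by
    simpa [Function.comp_def] using h3.trans_isBigO (by simpa [Function.comp_def] using h4)
  have h6 := h5.tendsto_div_nhds_zero.add_const (s * fderiv ℝ f a e)
  rw [zero_add] at h6
  refine h6.congr' ?_
  filter_upwards [Filter.eventually_gt_atTop 0] with l hl
  field_simp
  ring

end Taylor

lemma subLap_eq {f : ℝ × ℝ × ℝ → ℝ} (hf : ContDiff ℝ 2 f) (a : ℝ × ℝ × ℝ) :
    subLap f a = 1 / 4 *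
      (fderiv ℝ (fderiv ℝ f) a (1, 0, 2 * a.2.1) (1, 0, 2 * a.2.1) +
        fderiv ℝ (fderiv ℝ f) a (0, 1, -(2 * a.1)) (0, 1, -(2 * a.1))) := by
  have hf' : Differentiable ℝ (fderiv ℝ f) :=
    (hf.fderiv_right (m := 1) (by norm_num)).differentiable (by norm_num)
  have hd := (hf' a).hasFDerivAt
  have hx : HasFDerivAt (fun p : ℝ × ℝ × ℝ => p.1) (ContinuousLinearMap.fst ℝ ℝ (ℝ × ℝ)) a :=
    hasFDerivAt_fst
  have hy : HasFDerivAt (fun p : ℝ × ℝ × ℝ => p.2.1)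
      ((ContinuousLinearMap.fst ℝ ℝ ℝ).comp (ContinuousLinearMap.snd ℝ ℝ (ℝ × ℝ))) a :=
    hasFDerivAt_snd.fst
  have hX := hd.clm_apply (((hasFDerivAt_const (1 : ℝ) a).prodMk
    ((hasFDerivAt_const (0 : ℝ) a).prodMk (hy.const_mul 2))))
  have hY := hd.clm_apply (((hasFDerivAt_const (0 : ℝ) a).prodMk
    ((hasFDerivAt_const (1 : ℝ) a).prodMk (hx.const_mul 2).fun_neg)))
  have eX : Xop (Xop f) a =
      fderiv ℝ (fderiv ℝ f) a (1, 0, 2 * a.2.1) (1, 0, 2 * a.2.1) := by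
    rw [Xop, show Xop f = fun p => fderiv ℝ f p (1, 0, 2 * p.2.1) from rfl, hX.fderiv]
    simp
    exact map_zero (fderiv ℝ f a)
  have eY : Yop (Yop f) a =
      fderiv ℝ (fderiv ℝ f) a (0, 1, -(2 * a.1)) (0, 1, -(2 * a.1)) := by
    rw [Yop, show Yop f = fun p => fderiv ℝ f p (0, 1, -(2 * p.1)) from rfl, hY.fderiv]
    simp
    exact map_zero (fderiv ℝ f a)
  rw [subLap, eX, eY]

lemma integral_affine_mul_bubbleKernel (c α β : ℝ) :
    Integrable (fun w : ℝ × ℝ × ℝ => (c + (w.1 * α + w.2.1 * β)) * bubbleKernel w) ∧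
      ∫ w : ℝ × ℝ × ℝ, (c + (w.1 * α + w.2.1 * β)) * bubbleKernel w = 0 := by
  have i0 : Integrable bubbleKernel := by
    simpa using integrable_mul_bubbleKernel (q := fun _ => 1) continuous_const 1 fun w => by
      rw [abs_one, one_mul]; nlinarith [sq_nonneg w.1, sq_nonneg w.2.1, abs_nonneg w.2.2]
  have i1 : Integrable fun w : ℝ × ℝ × ℝ => w.1 * bubbleKernel w :=
    integrable_mul_bubbleKernel (by fun_prop) 1 fun w => by
      nlinarith [sq_nonneg (|w.1| - 1), sq_abs w.1, sq_nonneg w.2.1, abs_nonneg w.2.2]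
  have i2 : Integrable fun w : ℝ × ℝ × ℝ => w.2.1 * bubbleKernel w :=
    integrable_mul_bubbleKernel (by fun_prop) 1 fun w => by
      nlinarith [sq_nonneg (|w.2.1| - 1), sq_abs w.2.1, sq_nonneg w.1, abs_nonneg w.2.2]
  have e : (fun w : ℝ × ℝ × ℝ => (c + (w.1 * α + w.2.1 * β)) * bubbleKernel w) = fun w =>
      c * bubbleKernel w + (α * (w.1 * bubbleKernel w) + β * (w.2.1 * bubbleKernel w)) := by
    ext w
    ring
  have j := (i1.const_mul α).fun_add (i2.const_mul β)
  rw [e]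
  refine ⟨(i0.const_mul c).add j, ?_⟩
  rw [integral_add (i0.const_mul c) j, integral_add (i1.const_mul α) (i2.const_mul β)]
  simp only [integral_const_mul, integral_bubbleKernel, integral_fst_mul_bubbleKernel,
    integral_snd_mul_bubbleKernel]
  ring

lemma integral_quadratic_mul_bubbleKernel (τ p q r : ℝ) :
    ∫ w : ℝ × ℝ × ℝ, (w.2.2 * τ + (w.1 ^ 2 * p + w.1 * w.2.1 * q + w.2.1 ^ 2 * r))
        * bubbleKernel w =
      -(1 / 4) * (p + r) *
        ∫ w : ℝ × ℝ × ℝ, (w.1 ^ 2 + w.2.1 ^ 2) / bubbleDenom w ^ 2 := by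
  have i1 : Integrable fun w : ℝ × ℝ × ℝ => w.2.2 * bubbleKernel w :=
    integrable_mul_bubbleKernel (by fun_prop) 1 fun w => by
      nlinarith [sq_nonneg w.1, sq_nonneg w.2.1]
  have i2 : Integrable fun w : ℝ × ℝ × ℝ => w.1 ^ 2 * bubbleKernel w :=
    integrable_mul_bubbleKernel (by fun_prop) 1 fun w => by
      rw [abs_of_nonneg (by positivity)]
      nlinarith [sq_nonneg w.2.1, abs_nonneg w.2.2]
  have i3 : Integrable fun w : ℝ × ℝ × ℝ => w.1 * w.2.1 * bubbleKernel w :=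
    integrable_mul_bubbleKernel (by fun_prop) 1 fun w => by
      rw [abs_mul]
      nlinarith [sq_nonneg (|w.1| - |w.2.1|), sq_abs w.1, sq_abs w.2.1, abs_nonneg w.2.2,
        sq_nonneg w.1, sq_nonneg w.2.1]
  have i4 : Integrable fun w : ℝ × ℝ × ℝ => w.2.1 ^ 2 * bubbleKernel w :=
    integrable_mul_bubbleKernel (by fun_prop) 1 fun w => by
      rw [abs_of_nonneg (by positivity)]
      nlinarith [sq_nonneg w.1, abs_nonneg w.2.2]
  have e : (fun w : ℝ × ℝ × ℝ => (w.2.2 * τ + (w.1 ^ 2 * p + w.1 * w.2.1 * q + w.2.1 ^ 2 * r))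
      * bubbleKernel w) = fun w => τ * (w.2.2 * bubbleKernel w) + (p * (w.1 ^ 2 * bubbleKernel w)
        + (q * (w.1 * w.2.1 * bubbleKernel w) + r * (w.2.1 ^ 2 * bubbleKernel w))) := by
    ext w
    ring
  have j34 := (i3.const_mul q).fun_add (i4.const_mul r)
  have j234 := (i2.const_mul p).fun_add j34
  rw [e, integral_add (i1.const_mul τ) j234, integral_add (i2.const_mul p) j34,
    integral_add (i3.const_mul q) (i4.const_mul r)]
  simp only [integral_const_mul, integral_thd_mul_bubbleKernel, integral_sq_fst_mul_bubbleKernel,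
    integral_fst_mul_snd_mul_bubbleKernel, integral_sq_snd_mul_bubbleKernel]
  ring

lemma tendsto_sq_mul_integral_mul_bubbleKernel {f : ℝ × ℝ × ℝ → ℝ} (hf : ContDiff ℝ 2 f) {C : ℝ}
    (hC : ∀ p : ℝ × ℝ × ℝ,
      |f p| ≤ C ∧ ‖fderiv ℝ f p‖ ≤ C ∧ ‖fderiv ℝ (fderiv ℝ f) p‖ ≤ C)
    (a X Y T : ℝ × ℝ × ℝ) :
    Filter.Tendsto (fun l : ℝ => l ^ 2 * ∫ w : ℝ × ℝ × ℝ,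
        f (a + l⁻¹ • (w.1 • X + w.2.1 • Y) + (l⁻¹ ^ 2 * w.2.2) • T) * bubbleKernel w)
      Filter.atTop (nhds (-(1 / 8) * (fderiv ℝ (fderiv ℝ f) a X X + fderiv ℝ (fderiv ℝ f) a Y Y)
        * ∫ w : ℝ × ℝ × ℝ, (w.1 ^ 2 + w.2.1 ^ 2) / bubbleDenom w ^ 2)) := by
  have hfc := hf.continuous
  have hC0 : 0 ≤ C := (abs_nonneg _).trans (hC a).1
  have haff : ∀ (l : ℝ) (w : ℝ × ℝ × ℝ), f a + l⁻¹ * fderiv ℝ f a (w.1 • X + w.2.1 • Y) =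
      f a + (w.1 * (l⁻¹ * fderiv ℝ f a X) + w.2.1 * (l⁻¹ * fderiv ℝ f a Y)) := fun l w => by
    simp only [map_add, map_smul, smul_eq_mul]
    ring
  have hsub : ∀ l : ℝ, l ^ 2 * ∫ w : ℝ × ℝ × ℝ,
        f (a + l⁻¹ • (w.1 • X + w.2.1 • Y) + (l⁻¹ ^ 2 * w.2.2) • T) * bubbleKernel w =
      ∫ w : ℝ × ℝ × ℝ, l ^ 2 *
        (f (a + l⁻¹ • (w.1 • X + w.2.1 • Y) + (l⁻¹ ^ 2 * w.2.2) • T)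
          - (f a + l⁻¹ * fderiv ℝ f a (w.1 • X + w.2.1 • Y))) * bubbleKernel w := fun l => by
    obtain ⟨hi, h0⟩ := integral_affine_mul_bubbleKernel (f a) (l⁻¹ * fderiv ℝ f a X)
      (l⁻¹ * fderiv ℝ f a Y)
    have hfi : Integrable fun w : ℝ × ℝ × ℝ =>
        f (a + l⁻¹ • (w.1 • X + w.2.1 • Y) + (l⁻¹ ^ 2 * w.2.2) • T) * bubbleKernel w :=
      integrable_mul_bubbleKernel (by fun_prop) C fun w => by
        refine (hC _).1.trans (le_mul_of_one_le_right hC0 ?_)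
        nlinarith [sq_nonneg w.1, sq_nonneg w.2.1, abs_nonneg w.2.2]
    simp only [mul_assoc (l ^ 2), sub_mul, haff]
    rw [integral_const_mul, integral_sub hfi hi, h0, sub_zero]
  simp only [hsub]
  have hlim : -(1 / 8) * (fderiv ℝ (fderiv ℝ f) a X X + fderiv ℝ (fderiv ℝ f) a Y Y)
        * ∫ w : ℝ × ℝ × ℝ, (w.1 ^ 2 + w.2.1 ^ 2) / bubbleDenom w ^ 2 =
      ∫ w : ℝ × ℝ × ℝ, (w.2.2 * fderiv ℝ f a T + 1 / 2 *
        fderiv ℝ (fderiv ℝ f) a (w.1 • X + w.2.1 • Y) (w.1 • X + w.2.1 • Y))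
          * bubbleKernel w := by
    rw [show -(1 / 8) * (fderiv ℝ (fderiv ℝ f) a X X + fderiv ℝ (fderiv ℝ f) a Y Y) =
        -(1 / 4) * (1 / 2 * fderiv ℝ (fderiv ℝ f) a X X
          + 1 / 2 * fderiv ℝ (fderiv ℝ f) a Y Y) by ring,
      ← integral_quadratic_mul_bubbleKernel (fderiv ℝ f a T) _
        (1 / 2 * (fderiv ℝ (fderiv ℝ f) a X Y + fderiv ℝ (fderiv ℝ f) a Y X))]
    congr 1
    ext w
    simp only [map_add, map_smul, add_apply, smul_apply, smul_eq_mul]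
    ring
  rw [hlim]
  refine tendsto_integral_filter_of_dominated_convergence
    (fun w => C * (‖T‖ + ‖X‖ ^ 2 + ‖Y‖ ^ 2) *
      ((1 + w.1 ^ 2 + w.2.1 ^ 2 + |w.2.2|) / bubbleDenom w ^ 2))
    (.of_forall fun l => ?_) ?_ (integrable_bubble_weight.const_mul _)
    (.of_forall fun w => ?_)
  · exact Continuous.aestronglyMeasurable
      (.mul (by fun_prop) continuous_bubbleKernel)
  · filter_upwards [Filter.eventually_gt_atTop 0] with l hl
    refine .of_forall fun w => ?_
    refine (abs_mul_bubbleKernel_le _ w).trans ?_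
    rw [← mul_div_assoc]
    refine div_le_div_of_nonneg_right ?_ (by positivity)
    set V := w.1 • X + w.2.1 • Y with hV
    have b1 := abs_add_sub_le_of_norm_fderiv_le (hf.differentiable (by norm_num))
      (fun p => (hC p).2.1) (a + l⁻¹ • V) ((l⁻¹ ^ 2 * w.2.2) • T)
    have b2 := abs_add_sub_sub_fderiv_le hf (fun p => (hC p).2.2) a (l⁻¹ • V)
    have hVn : ‖V‖ ^ 2 ≤ (w.1 ^ 2 + w.2.1 ^ 2) * (‖X‖ ^ 2 + ‖Y‖ ^ 2) := by
      have : ‖V‖ ≤ |w.1| * ‖X‖ + |w.2.1| * ‖Y‖ := by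
        refine (norm_add_le _ _).trans_eq ?_
        rw [norm_smul, norm_smul, norm_eq_abs, norm_eq_abs]
      calc ‖V‖ ^ 2 ≤ (|w.1| * ‖X‖ + |w.2.1| * ‖Y‖) ^ 2 := by gcongr
        _ ≤ (|w.1| ^ 2 + |w.2.1| ^ 2) * (‖X‖ ^ 2 + ‖Y‖ ^ 2) := by
          nlinarith [sq_nonneg (|w.1| * ‖Y‖ - |w.2.1| * ‖X‖)]
        _ = _ := by rw [sq_abs, sq_abs]
    rw [norm_smul, norm_mul, norm_of_nonneg (by positivity : 0 ≤ l⁻¹ ^ 2), norm_eq_abs] at b1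
    rw [norm_smul, norm_of_nonneg (by positivity : 0 ≤ l⁻¹), map_smul, smul_eq_mul] at b2
    rw [abs_mul, abs_of_pos (by positivity : 0 < l ^ 2)]
    calc l ^ 2 * |f (a + l⁻¹ • V + (l⁻¹ ^ 2 * w.2.2) • T) - (f a + l⁻¹ * fderiv ℝ f a V)|
        ≤ l ^ 2 * (C * (l⁻¹ ^ 2 * |w.2.2| * ‖T‖) + C * (l⁻¹ * ‖V‖) ^ 2) := by
          gcongr
          refine le_trans (le_of_eq ?_) ((abs_add_le _ _).trans (add_le_add b1 b2))
          congr 1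
          ring
      _ = C * (|w.2.2| * ‖T‖ + ‖V‖ ^ 2) := by field_simp
      _ ≤ C * (|w.2.2| * ‖T‖ + (w.1 ^ 2 + w.2.1 ^ 2) * (‖X‖ ^ 2 + ‖Y‖ ^ 2)) := by gcongr
      _ ≤ C * ((‖T‖ + ‖X‖ ^ 2 + ‖Y‖ ^ 2) * (1 + w.1 ^ 2 + w.2.1 ^ 2 + |w.2.2|)) := by
          gcongr
          have hT := norm_nonneg T
          have hXY : 0 ≤ ‖X‖ ^ 2 + ‖Y‖ ^ 2 := by positivity
          have hw : 0 ≤ 1 + w.1 ^ 2 + w.2.1 ^ 2 := by positivity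
          nlinarith [mul_nonneg hT hw, mul_nonneg hXY (abs_nonneg w.2.2)]
      _ = _ := by ring
  · refine Filter.Tendsto.mul_const _ ?_
    refine ((tendsto_sq_mul_increment hf a (w.1 • X + w.2.1 • Y) T w.2.2).add
      (tendsto_sq_mul_second_order_remainder hf a (w.1 • X + w.2.1 • Y))).congr fun l => ?_
    ring

/-- Asymptotic from Lemma B.3.1:
`lim_{λ→∞} λ²·∫ f(u)·δ_{a,λ}(u)^{(2+γ)/(2−γ)}·λ·(∂δ_{a,λ}/∂λ)(u) du
  = −((2−γ)/8)·c₂·Δ_{θ₀}f(a)`. -/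
theorem bubble_lambda_deriv_concentration (γ : ℝ) (hγ : γ ∈ Set.Ioo (0 : ℝ) 1)
    (c₀ : ℝ) (hc₀ : 0 < c₀) (f : ℝ × ℝ × ℝ → ℝ) (hf : ContDiff ℝ 2 f)
    (hbd : ∃ C : ℝ, ∀ p : ℝ × ℝ × ℝ,
      |f p| ≤ C ∧ ‖fderiv ℝ f p‖ ≤ C ∧ ‖fderiv ℝ (fderiv ℝ f) p‖ ≤ C)
    (a : ℝ × ℝ × ℝ) :
    Filter.Tendsto
      (fun l : ℝ =>
        l ^ 2 * ∫ u : ℝ × ℝ × ℝ,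
          f u * bubble γ c₀ a l u ^ ((2 + γ) / (2 - γ))
            * (l * deriv (fun s => bubble γ c₀ a s u) l))
      Filter.atTop (nhds (-((2 - γ) / 8) * c2const γ c₀ * subLap f a)) := by
  obtain ⟨C, hC⟩ := hbd
  have hγ2 : γ < 2 := by linarith [hγ.2]
  have h := (tendsto_sq_mul_integral_mul_bubbleKernel hf hC a (1, 0, 2 * a.2.1)
    (0, 1, -(2 * a.1)) (0, 0, 1)).const_mul ((2 - γ) * c₀ ^ (4 / (2 - γ)))
  have hlim : -((2 - γ) / 8) * c2const γ c₀ * subLap f a =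
      (2 - γ) * c₀ ^ (4 / (2 - γ)) * (-(1 / 8) *
        (fderiv ℝ (fderiv ℝ f) a (1, 0, 2 * a.2.1) (1, 0, 2 * a.2.1)
          + fderiv ℝ (fderiv ℝ f) a (0, 1, -(2 * a.1)) (0, 1, -(2 * a.1)))
        * ∫ w : ℝ × ℝ × ℝ, (w.1 ^ 2 + w.2.1 ^ 2) / bubbleDenom w ^ 2) := by
    rw [subLap_eq hf]
    simp only [c2const, bubbleDenom]
    ring
  rw [hlim]
  refine h.congr' ?_
  filter_upwards [Filter.eventually_gt_atTop 0] with l hl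
  rw [integral_mul_bubble_deriv hγ2 hc₀ f a hl]
  ring
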